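/- arXiv:2104.11049 — 2 statements merged into one kernel-verified Lean document; each statement's English description precedes it below -/
import Mathlib

section
/- (Lemma 1.) Let N ≥ 1 and m : ℕ → ℂ. The following are equivalent: (a) there exist monic polynomials P, R ∈ ℂ[z] of degree N that are coprime in ℂ[z] and satisfy R̂ − P̂ = (R̂ + P̂) · Σ_{k≥0} m_k t^{k+1} in ℂ[[t]]; (b) det L_N(m) ≠ 0 and det L_n(m) = 0 for every integer n > N. -/
open Polynomial Finset

/-- The formal power series `Σ_{k≥0} m_k t^{k+1}`. -/
noncomputable def tailSeries (m : ℕ → ℂ) : PowerSeries ℂ :=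
  PowerSeries.mk fun n => if n = 0 then 0 else m (n - 1)

/-- The `i × i` matrix `L_i(m)` whose 1-indexed `(j,k)` entry is `m_{(i-j)+(k-1)}`. -/
def Lmat (i : ℕ) (m : ℕ → ℂ) : Matrix (Fin i) (Fin i) ℂ :=
  Matrix.of fun j k => m ((i - 1 - (j : ℕ)) + (k : ℕ))

/-- The linear functional on `ℂ[X]` sending `X ^ k` to `m k`. -/
noncomputable def momentFunctional (m : ℕ → ℂ) : ℂ[X] →ₗ[ℂ] ℂ :=
  Polynomial.lsum fun k => m k • LinearMap.id

theorem momentFunctional_monomial (m : ℕ → ℂ) (k : ℕ) (a : ℂ) :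
    momentFunctional m (monomial k a) = m k * a := by
  simp [momentFunctional, Polynomial.lsum_apply, Polynomial.sum_monomial_index]

theorem momentFunctional_mul_X_pow (m : ℕ → ℂ) {n : ℕ} {V : ℂ[X]} (hV : V.degree < n) (l : ℕ) :
    momentFunctional m (V * X ^ l) = ∑ k ∈ range n, V.coeff k * m (k + l) := by
  have hsum : V = ∑ k ∈ range n, monomial k (V.coeff k) := by
    ext k
    simp only [finsetSum_coeff, coeff_monomial, sum_ite_eq', mem_range]
    split_ifs with hk
    · rfl
    · exact coeff_eq_zero_of_degree_lt (hV.trans_le (by exact_mod_cast not_lt.1 hk))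
  conv_lhs => rw [hsum]
  simp only [Finset.sum_mul, map_sum, X_pow_eq_monomial, monomial_mul_monomial, mul_one,
    momentFunctional_monomial]
  exact sum_congr rfl fun k _ => mul_comm _ _

theorem momentFunctional_mul_of_forall_lt {m : ℕ → ℂ} {V U : ℂ[X]} {K : ℕ}
    (hV : ∀ l < K, momentFunctional m (V * X ^ l) = 0) (hU : U.natDegree ≤ K) :
    momentFunctional m (V * U) = U.coeff K * momentFunctional m (V * X ^ K) := by
  conv_lhs => rw [as_sum_range' U (K + 1) (Nat.lt_succ_of_le hU)]
  have h : ∀ l, momentFunctional m (V * monomial l (U.coeff l))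
      = U.coeff l * momentFunctional m (V * X ^ l) := fun l => by
    rw [← C_mul_X_pow_eq_monomial, mul_left_comm, ← smul_eq_C_mul, map_smul, smul_eq_mul]
  rw [Finset.mul_sum, map_sum, sum_range_succ, h, sum_eq_zero, zero_add]
  intro l hl
  rw [h, hV l (mem_range.1 hl), mul_zero]

theorem momentFunctional_mul_eq_zero {m : ℕ → ℂ} {V U : ℂ[X]} {n : ℕ}
    (hV : ∀ l < n, momentFunctional m (V * X ^ l) = 0) (hU : U.degree < n) :
    momentFunctional m (V * U) = 0 := by
  rw [momentFunctional_mul_of_forall_lt hV (natDegree_le_of_degree_le hU.le),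
    coeff_eq_zero_of_degree_lt hU, zero_mul]

theorem det_Lmat_eq_zero_iff (m : ℕ → ℂ) (n : ℕ) :
    (Lmat n m).det = 0 ↔ ∃ V : ℂ[X], V ≠ 0 ∧ V.degree < n ∧
      ∀ l < n, momentFunctional m (V * X ^ l) = 0 := by
  have mulVec_coeff (V : ℂ[X]) (hV : V.degree < n) (j : Fin n) :
      (Lmat n m).mulVec (fun k : Fin n => V.coeff k) j =
        momentFunctional m (V * X ^ (n - 1 - (j : ℕ))) := by
    rw [momentFunctional_mul_X_pow m hV,
      ← Fin.sum_univ_eq_sum_range (fun k => V.coeff k * m (k + (n - 1 - (j : ℕ)))) n,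
      Matrix.mulVec, dotProduct]
    refine sum_congr rfl fun k _ => ?_
    rw [Lmat, Matrix.of_apply, mul_comm, add_comm]
  rw [← Matrix.exists_mulVec_eq_zero_iff]
  constructor
  · rintro ⟨v, hv, h⟩
    set V : ℂ[X] := ((degreeLTEquiv ℂ n).symm v).1
    have hV : V.degree < n := mem_degreeLT.1 ((degreeLTEquiv ℂ n).symm v).2
    have hc : (fun k : Fin n => V.coeff k) = v := (degreeLTEquiv ℂ n).apply_symm_apply v
    refine ⟨V, ?_, hV, fun l hl => ?_⟩
    · rintro h0
      exact hv (by rw [← hc, h0]; ext; simp)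
    · have := mulVec_coeff V hV ⟨n - 1 - l, by omega⟩
      rw [hc, h] at this
      rw [show l = n - 1 - (n - 1 - l) by omega, ← this, Pi.zero_apply]
  · rintro ⟨V, hV0, hV, h⟩
    refine ⟨fun k => V.coeff k, fun h0 => hV0 ?_, ?_⟩
    · ext k
      by_cases hk : k < n
      · exact congrFun h0 ⟨k, hk⟩
      · rw [coeff_zero, coeff_eq_zero_of_degree_lt (hV.trans_le (by exact_mod_cast not_lt.1 hk))]
    · ext j
      rw [mulVec_coeff V hV, h _ (by omega), Pi.zero_apply]

theorem coeff_reflect_mul_tailSeries (m : ℕ → ℂ) {N : ℕ} {V : ℂ[X]} (hV : V.natDegree ≤ N) (l : ℕ) :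
    PowerSeries.coeff (N + 1 + l) (((reflect N V : ℂ[X]) : PowerSeries ℂ) * tailSeries m)
      = momentFunctional m (V * X ^ l) := by
  rw [momentFunctional_mul_X_pow m (n := N + 1)
    (degree_le_natDegree.trans_lt (by exact_mod_cast Nat.lt_succ_of_le hV)),
    PowerSeries.coeff_mul, Nat.sum_antidiagonal_eq_sum_range_succ_mk,
    ← sum_subset (range_mono (show N + 1 ≤ (N + 1 + l).succ by omega)), ← sum_range_reflect]
  · refine sum_congr rfl fun k hk => ?_
    have hk : k ≤ N := Nat.lt_succ_iff.1 (mem_range.1 hk)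
    rw [coeff_coe, coeff_reflect, revAt_le (by omega), tailSeries, PowerSeries.coeff_mk,
      if_neg (by omega)]
    congr 2 <;> omega
  · intro k _ hk
    have hk : N < k := by
      rw [mem_range] at hk; omega
    rw [coeff_coe, coeff_reflect, revAt_eq_self_of_lt hk, coeff_eq_zero_of_natDegree_lt (by omega),
      zero_mul]

theorem reflect_injective (N : ℕ) : Function.Injective (reflect N : ℂ[X] → ℂ[X]) := by
  intro f g h
  ext k
  simpa [coeff_reflect] using congrArg (fun p => coeff p (revAt N k)) h

theorem exists_reflect_eq_iff (m : ℕ → ℂ) {N : ℕ} {V : ℂ[X]} (hV : V.natDegree ≤ N) :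
    (∃ E : ℂ[X], E.natDegree ≤ N ∧
        ((reflect N E : ℂ[X]) : PowerSeries ℂ) = (reflect N V : ℂ[X]) * tailSeries m)
      ↔ ∀ l, momentFunctional m (V * X ^ l) = 0 := by
  constructor
  · rintro ⟨E, hE, h⟩ l
    rw [← coeff_reflect_mul_tailSeries m hV, ← h, coeff_coe, coeff_reflect,
      revAt_eq_self_of_lt (by omega), coeff_eq_zero_of_natDegree_lt (by omega)]
  · intro h
    set F := (reflect N V : ℂ[X]) * tailSeries m with hF
    have hd : (PowerSeries.trunc (N + 1) F).natDegree ≤ N :=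
      Nat.lt_succ_iff.1 (PowerSeries.natDegree_trunc_lt F N)
    refine ⟨reflect N (PowerSeries.trunc (N + 1) F), ?_, ?_⟩
    · rw [natDegree_le_iff_coeff_eq_zero]
      intro k hk
      rw [coeff_reflect, revAt_eq_self_of_lt hk, coeff_eq_zero_of_natDegree_lt (by omega)]
    · rw [reflect_reflect]
      ext k
      rw [coeff_coe, PowerSeries.coeff_trunc]
      split_ifs with hk
      · rfl
      · obtain ⟨l, rfl⟩ := Nat.exists_eq_add_of_le (not_lt.1 hk)
        rw [hF, coeff_reflect_mul_tailSeries m hV, h]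

/-- If `T / S` expands as the moment series, then `V` annihilates the moments exactly when
`S ∣ T * V`. -/
theorem dvd_mul_iff_forall_momentFunctional {m : ℕ → ℂ} {N : ℕ} {S T V : ℂ[X]} (hS0 : S ≠ 0)
    (hS : S.natDegree = N) (hT : T.natDegree ≤ N)
    (h : ((reflect N T : ℂ[X]) : PowerSeries ℂ) = (reflect N S : ℂ[X]) * tailSeries m)
    (hV : V.natDegree ≤ N) :
    S ∣ T * V ↔ ∀ l, momentFunctional m (V * X ^ l) = 0 := by
  have hSr : ((reflect N S : ℂ[X]) : PowerSeries ℂ) ≠ 0 := by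
    rw [Ne, Polynomial.coe_eq_zero_iff, reflect_eq_zero_iff]
    exact hS0
  rw [← exists_reflect_eq_iff m hV]
  have key (E : ℂ[X]) (hE : E.natDegree ≤ N) : T * V = S * E ↔
      ((reflect N E : ℂ[X]) : PowerSeries ℂ) = (reflect N V : ℂ[X]) * tailSeries m := by
    rw [← (reflect_injective (N + N)).eq_iff, reflect_mul _ _ hT hV, reflect_mul _ _ hS.le hE,
      ← Polynomial.coe_inj, Polynomial.coe_mul, Polynomial.coe_mul, h, mul_assoc, mul_right_inj' hSr, mul_comm, eq_comm,
      mul_comm]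
  constructor
  · rintro ⟨E, hE⟩
    have hEN : E.natDegree ≤ N := by
      rcases eq_or_ne E 0 with rfl | hE0
      · simp
      have h1 := natDegree_mul_le (p := T) (q := V)
      rw [hE, natDegree_mul hS0 hE0] at h1
      omega
    exact ⟨E, hEN, (key E hEN).1 hE⟩
  · rintro ⟨E, hE, hEV⟩
    exact ⟨E, (key E hE).2 hEV⟩

theorem det_Lmat_ne_zero_of_isCoprime {m : ℕ → ℂ} {N : ℕ} {S T : ℂ[X]} (hS0 : S ≠ 0)
    (hS : S.natDegree = N) (hT : T.natDegree ≤ N) (hc : IsCoprime S T)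
    (h : ((reflect N T : ℂ[X]) : PowerSeries ℂ) = (reflect N S : ℂ[X]) * tailSeries m) :
    (Lmat N m).det ≠ 0 ∧ ∀ n, N < n → (Lmat n m).det = 0 := by
  have hSm : ∀ l, momentFunctional m (S * X ^ l) = 0 :=
    (exists_reflect_eq_iff m hS.le).1 ⟨T, hT, h⟩
  have hSd : S.degree = N := by rw [degree_eq_natDegree hS0, hS]
  refine ⟨fun hdet => ?_, fun n hn => ?_⟩
  · obtain ⟨V, hV0, hV, hVm⟩ := (det_Lmat_eq_zero_iff m N).1 hdet
    have hVall (l : ℕ) : momentFunctional m (V * X ^ l) = 0 := by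
      have hmod : (X ^ l % S : ℂ[X]).degree < (N : WithBot ℕ) := by
        rw [← hSd]; exact EuclideanDomain.mod_lt (X ^ l) hS0
      rw [← EuclideanDomain.div_add_mod (X ^ l : ℂ[X]) S, mul_add, map_add,
        momentFunctional_mul_eq_zero hVm hmod, add_zero, mul_left_comm]
      exact momentFunctional_mul_eq_zero (n := (V * (X ^ l / S)).natDegree + 1)
        (fun k _ => hSm k) (degree_le_natDegree.trans_lt (by exact_mod_cast Nat.lt_succ_self _))
    have hdvd := (dvd_mul_iff_forall_momentFunctional hS0 hS hT h
      (natDegree_le_of_degree_le hV.le)).2 hVall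
    exact hV0 (eq_zero_of_dvd_of_degree_lt (hc.dvd_of_dvd_mul_left hdvd) (hSd ▸ hV))
  · exact (det_Lmat_eq_zero_iff m n).2 ⟨S, hS0, hSd ▸ (by exact_mod_cast hn), fun l _ => hSm l⟩

theorem exists_monic_forall_momentFunctional_eq_zero {m : ℕ → ℂ} {N : ℕ}
    (hN : (Lmat N m).det ≠ 0) (h : ∀ n, N < n → (Lmat n m).det = 0) :
    ∃ Q : ℂ[X], Q.Monic ∧ Q.natDegree = N ∧ ∀ l, momentFunctional m (Q * X ^ l) = 0 := by
  have exists_kernel (L : ℕ) (hL : N ≤ L) : ∃ V : ℂ[X], V ≠ 0 ∧ N ≤ V.natDegree ∧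
      V.natDegree ≤ L ∧ ∀ l < L + 1, momentFunctional m (V * X ^ l) = 0 := by
    obtain ⟨V, hV0, hV, hVm⟩ := (det_Lmat_eq_zero_iff m (L + 1)).1 (h _ (by omega))
    refine ⟨V, hV0, ?_, natDegree_le_of_degree_le (Order.le_of_lt_succ hV), hVm⟩
    by_contra! hlt
    exact hN ((det_Lmat_eq_zero_iff m N).2 ⟨V, hV0, (natDegree_lt_iff_degree_lt hV0).1 hlt,
      fun l hl => hVm l (by omega)⟩)
  obtain ⟨V, hV0, hVN, hVN', hVm⟩ := exists_kernel N le_rfl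
  have hlc := leadingCoeff_ne_zero.2 hV0
  refine ⟨C V.leadingCoeff⁻¹ * V, ?_, ?_, ?_⟩
  · rw [mul_comm]; exact monic_mul_leadingCoeff_inv hV0
  · rw [natDegree_C_mul (inv_ne_zero hlc)]; omega
  have hVall (l : ℕ) : momentFunctional m (V * X ^ l) = 0 := by
    induction l using Nat.strong_induction_on with
    | _ L ih =>
      rcases lt_or_ge L N with hL | hL
      · exact hVm L (by omega)
      obtain ⟨W, hW0, hWN, hWL, hWm⟩ := exists_kernel L hL
      have hdeg : (W * X ^ (L - W.natDegree)).natDegree = L := by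
        rw [natDegree_mul_X_pow _ hW0]; omega
      have h1 := momentFunctional_mul_of_forall_lt ih hdeg.le
      have h2 : momentFunctional m (W * (V * X ^ (L - W.natDegree))) = 0 := by
        refine momentFunctional_mul_eq_zero hWm ?_
        rw [degree_lt_iff_coeff_zero]
        intro k hk
        refine coeff_eq_zero_of_natDegree_lt ?_
        rw [natDegree_mul_X_pow _ hV0]; omega
      rw [mul_left_comm, h2] at h1
      refine (mul_eq_zero.1 h1.symm).resolve_left ?_
      have hne : W * X ^ (L - W.natDegree) ≠ 0 := mul_ne_zero hW0 (pow_ne_zero _ X_ne_zero)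
      simpa only [leadingCoeff, hdeg] using leadingCoeff_ne_zero.2 hne
  intro l
  rw [mul_assoc, ← smul_eq_C_mul, map_smul, hVall, smul_zero]

theorem isCoprime_of_det_Lmat_ne_zero {m : ℕ → ℂ} {N : ℕ} {S T : ℂ[X]} (hS0 : S ≠ 0)
    (hS : S.natDegree = N) (hT : T.natDegree ≤ N) (hdet : (Lmat N m).det ≠ 0)
    (h : ((reflect N T : ℂ[X]) : PowerSeries ℂ) = (reflect N S : ℂ[X]) * tailSeries m) :
    IsCoprime S T := by
  rw [← EuclideanDomain.gcd_isUnit_iff]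
  by_contra hu
  obtain ⟨V, hV⟩ := EuclideanDomain.gcd_dvd_left S T
  obtain ⟨E, hE⟩ := EuclideanDomain.gcd_dvd_right S T
  set G := EuclideanDomain.gcd S T
  have hG0 : G ≠ 0 := by rintro h0; exact hS0 (by rw [hV, h0, zero_mul])
  have hV0 : V ≠ 0 := by rintro h0; exact hS0 (by rw [hV, h0, mul_zero])
  have hlt : V.natDegree < N := by
    rw [← hS, hV, natDegree_mul hG0 hV0]
    have : G.natDegree ≠ 0 := fun h0 => hu
      (isUnit_iff_degree_eq_zero.2 (by rw [degree_eq_natDegree hG0, h0]; rfl))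
    omega
  refine hdet ((det_Lmat_eq_zero_iff m N).2 ⟨V, hV0, (natDegree_lt_iff_degree_lt hV0).1 hlt,
    fun l _ => (dvd_mul_iff_forall_momentFunctional hS0 hS hT h hlt.le).1 ⟨E, ?_⟩ l⟩)
  conv_lhs => rw [hE]
  conv_rhs => rw [hV]
  ring

/-- Lemma 1. -/
theorem stmt6 (N : ℕ) (hN : 1 ≤ N) (m : ℕ → ℂ) :
    (∃ P R : Polynomial ℂ, P.Monic ∧ R.Monic ∧ P.natDegree = N ∧ R.natDegree = N ∧
        IsCoprime P R ∧
        ((reflect N R : Polynomial ℂ) : PowerSeries ℂ) - ((reflect N P : Polynomial ℂ) : PowerSeries ℂ)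
          = (((reflect N R : Polynomial ℂ) : PowerSeries ℂ)
              + ((reflect N P : Polynomial ℂ) : PowerSeries ℂ)) * tailSeries m)
      ↔ ((Lmat N m).det ≠ 0 ∧ ∀ n, N < n → (Lmat n m).det = 0) := by
  have half : (C (1 / 2) : ℂ[X]) * 2 = 1 := by
    rw [show (2 : ℂ[X]) = C 2 from rfl, ← C_mul]; norm_num
  constructor
  · rintro ⟨P, R, hP, hR, hPN, hRN, ⟨a, b, hab⟩, h⟩
    have hcoeff : (R + P).coeff N = 2 := by
      rw [coeff_add]
      conv_lhs => enter [1, 2]; rw [← hRN]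
      conv_lhs => enter [2, 2]; rw [← hPN]
      rw [hR.coeff_natDegree, hP.coeff_natDegree]; norm_num
    have hS : (R + P).natDegree = N :=
      natDegree_eq_of_le_of_coeff_ne_zero
        ((natDegree_add_le _ _).trans (by simp [hPN, hRN])) (by rw [hcoeff]; norm_num)
    refine det_Lmat_ne_zero_of_isCoprime (S := R + P) (T := R - P) ?_ hS
      ((natDegree_sub_le _ _).trans (by simp [hPN, hRN])) ?_ ?_
    · rintro h0; rw [h0] at hcoeff; simp at hcoeff
    · refine ⟨C (1 / 2) * (a + b), C (1 / 2) * (b - a), ?_⟩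
      linear_combination (a * P + b * R) * half + hab
    · rw [reflect_sub, reflect_add, Polynomial.coe_sub, Polynomial.coe_add, h]
  · rintro ⟨hdet, hdet'⟩
    obtain ⟨Q, hQ, hQN, hQm⟩ := exists_monic_forall_momentFunctional_eq_zero hdet hdet'
    obtain ⟨D, hD, hDQ⟩ := (exists_reflect_eq_iff m hQN.le).2 hQm
    have hDc : D.coeff N = 0 := by
      have h0 := congrArg (PowerSeries.coeff 0) hDQ
      simpa [coeff_reflect, tailSeries] using h0
    have hDlt : D.degree < Q.degree := by
      rw [degree_eq_natDegree hQ.ne_zero, hQN, degree_lt_iff_coeff_zero]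
      intro k hk
      rcases hk.eq_or_lt with rfl | hk
      · exact hDc
      · exact coeff_eq_zero_of_natDegree_lt (by omega)
    obtain ⟨a, b, hab⟩ := isCoprime_of_det_Lmat_ne_zero hQ.ne_zero hQN hD hdet hDQ
    refine ⟨Q - D, Q + D, hQ.sub_of_left hDlt, hQ.add_of_left hDlt, ?_, ?_,
      ⟨C (1 / 2) * (a - b), C (1 / 2) * (a + b), ?_⟩, ?_⟩
    · rw [natDegree_eq_of_degree_eq (degree_sub_eq_left_of_degree_lt hDlt), hQN]
    · rw [natDegree_add_eq_left_of_degree_lt hDlt, hQN]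
    · linear_combination (a * Q + b * D) * half + hab
    · rw [reflect_sub, reflect_add, Polynomial.coe_sub, Polynomial.coe_add, hDQ]
      ring
end

section
/- Let a_1, a_2, b_1, b_2, c_1, c_2 ∈ ℂ, P(z) = z² + a_1 z + a_2, R(z) = z² + b_1 z + b_2, Q(z) = c_1 z + c_2, and let m, q : ℕ → ℂ be the unique sequences with R̂ − P̂ = (R̂ + P̂)·Σ_{k≥0} m_k t^{k+1} and 2Q̂ = (R̂ + P̂)·Σ_{k≥0} q_k t^{k+1} in ℂ[[t]]. If m_1² − m_0 m_2 ≠ 0, then: a_1 = (m_0²m_2 − m_0m_1² + m_0m_3 − m_1m_2)/(m_1² − m_0m_2); a_2 = (m_1³ + (m_3 − 2m_0m_2)m_1 − m_2² + m_0²m_3)/(m_0m_2 − m_1²); b_1 = (m_0m_1² − m_0²m_2 + m_0m_3 − m_1m_2)/(m_1² − m_0m_2); b_2 = (m_1³ + m_2² + m_0²m_3 − m_1(2m_0m_2 + m_3))/(m_1² − m_0m_2); c_1 = q_0; c_2 = (m_1²q_1 − m_1m_2q_0 + m_0(m_3q_0 − m_2q_1))/(m_1² − m_0m_2). -/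
open Polynomial Finset

theorem coeff_tailSeries_zero (m : ℕ → ℂ) : PowerSeries.coeff 0 (tailSeries m) = 0 := by
  simp [tailSeries]

theorem coeff_tailSeries_succ (m : ℕ → ℂ) (n : ℕ) :
    PowerSeries.coeff (n + 1) (tailSeries m) = m n := by
  simp [tailSeries]

theorem reflect_two_quadratic (u v w : ℂ) :
    reflect 2 (Polynomial.C u * X ^ 2 + Polynomial.C v * X + Polynomial.C w) =
      Polynomial.C u + Polynomial.C v * X + Polynomial.C w * X ^ 2 := by
  have h := reflect_C_mul_X_pow 2 1 (c := v)
  rw [pow_one] at h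
  rw [reflect_add, reflect_add, reflect_C_mul_X_pow, h, reflect_C,
    revAt_le le_rfl, revAt_le one_le_two]
  simp

/-- Coefficients of the product of a quadratic power series with a series `tailSeries m`. -/
theorem coeff_quadratic_mul_tailSeries (u v w : ℂ) (m : ℕ → ℂ) (n : ℕ) :
    PowerSeries.coeff n
        (((Polynomial.C u + Polynomial.C v * X + Polynomial.C w * X ^ 2 : Polynomial ℂ) :
          PowerSeries ℂ) * tailSeries m) =
      u * PowerSeries.coeff n (tailSeries m) +
        v * (if 1 ≤ n then PowerSeries.coeff (n - 1) (tailSeries m) else 0) +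
        w * (if 2 ≤ n then PowerSeries.coeff (n - 2) (tailSeries m) else 0) := by
  have h := PowerSeries.coeff_X_pow_mul' (tailSeries m) 1 n
  rw [pow_one] at h
  simp only [Polynomial.coe_add, Polynomial.coe_mul, Polynomial.coe_pow, Polynomial.coe_C,
    Polynomial.coe_X, add_mul, mul_assoc, map_add, PowerSeries.coeff_C_mul,
    PowerSeries.coeff_X_pow_mul', h]

/-- Comparison of coefficients in `N = D · Σ_{k≥0} m_k t^{k+1}` for quadratic `N` and `D`. -/
theorem recurrence_of_eq_mul_tailSeries {x y z u v w : ℂ} {m : ℕ → ℂ}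
    (h : ((Polynomial.C x + Polynomial.C y * X + Polynomial.C z * X ^ 2 : Polynomial ℂ) :
          PowerSeries ℂ) =
        ((Polynomial.C u + Polynomial.C v * X + Polynomial.C w * X ^ 2 : Polynomial ℂ) :
          PowerSeries ℂ) * tailSeries m) :
    y = u * m 0 ∧ z = u * m 1 + v * m 0 ∧
      ∀ n, u * m (n + 2) + v * m (n + 1) + w * m n = 0 := by
  have key (n : ℕ) := congrArg (PowerSeries.coeff n) h
  simp only [coeff_quadratic_mul_tailSeries, Polynomial.coeff_coe] at key
  refine ⟨?_, ?_, fun n => ?_⟩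
  · simpa [coeff_tailSeries_succ _ 0, -PowerSeries.coeff_zero_eq_constantCoeff,
      coeff_tailSeries_zero, coeff_X, coeff_C, coeff_X_pow] using key 1
  · simpa [coeff_tailSeries_succ _ 0, coeff_tailSeries_succ _ 1,
      -PowerSeries.coeff_zero_eq_constantCoeff,
      coeff_tailSeries_zero, coeff_X, coeff_C, coeff_X_pow] using key 2
  · have h3 := key (n + 3)
    rw [show n + 3 - 1 = n + 1 + 1 by omega, show n + 3 - 2 = n + 1 by omega,
      coeff_tailSeries_succ, coeff_tailSeries_succ, coeff_tailSeries_succ] at h3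
    simpa [coeff_X, coeff_C, coeff_X_pow] using h3.symm

theorem stmt15 (a₁ a₂ b₁ b₂ c₁ c₂ : ℂ) (P R Q : Polynomial ℂ)
    (hP : P = X ^ 2 + Polynomial.C a₁ * X + Polynomial.C a₂)
    (hR : R = X ^ 2 + Polynomial.C b₁ * X + Polynomial.C b₂)
    (hQ : Q = Polynomial.C c₁ * X + Polynomial.C c₂)
    (m q : ℕ → ℂ)
    (hm : ((reflect 2 R : Polynomial ℂ) : PowerSeries ℂ) - ((reflect 2 P : Polynomial ℂ) : PowerSeries ℂ)
        = (((reflect 2 R : Polynomial ℂ) : PowerSeries ℂ)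
            + ((reflect 2 P : Polynomial ℂ) : PowerSeries ℂ)) * tailSeries m)
    (hq : (2 : PowerSeries ℂ) * ((reflect 2 Q : Polynomial ℂ) : PowerSeries ℂ)
        = (((reflect 2 R : Polynomial ℂ) : PowerSeries ℂ)
            + ((reflect 2 P : Polynomial ℂ) : PowerSeries ℂ)) * tailSeries q)
    (hne : m 1 ^ 2 - m 0 * m 2 ≠ 0) :
    a₁ = (m 0 ^ 2 * m 2 - m 0 * m 1 ^ 2 + m 0 * m 3 - m 1 * m 2) / (m 1 ^ 2 - m 0 * m 2) ∧
    a₂ = (m 1 ^ 3 + (m 3 - 2 * m 0 * m 2) * m 1 - m 2 ^ 2 + m 0 ^ 2 * m 3) / (m 0 * m 2 - m 1 ^ 2) ∧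
    b₁ = (m 0 * m 1 ^ 2 - m 0 ^ 2 * m 2 + m 0 * m 3 - m 1 * m 2) / (m 1 ^ 2 - m 0 * m 2) ∧
    b₂ = (m 1 ^ 3 + m 2 ^ 2 + m 0 ^ 2 * m 3 - m 1 * (2 * m 0 * m 2 + m 3)) / (m 1 ^ 2 - m 0 * m 2) ∧
    c₁ = q 0 ∧
    c₂ = (m 1 ^ 2 * q 1 - m 1 * m 2 * q 0 + m 0 * (m 3 * q 0 - m 2 * q 1)) / (m 1 ^ 2 - m 0 * m 2) := by
  have hP' : reflect 2 P = Polynomial.C 1 + Polynomial.C a₁ * X + Polynomial.C a₂ * X ^ 2 := by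
    rw [← reflect_two_quadratic, hP, Polynomial.C_1, one_mul]
  have hR' : reflect 2 R = Polynomial.C 1 + Polynomial.C b₁ * X + Polynomial.C b₂ * X ^ 2 := by
    rw [← reflect_two_quadratic, hR, Polynomial.C_1, one_mul]
  have hQ' : reflect 2 Q = Polynomial.C 0 + Polynomial.C c₁ * X + Polynomial.C c₂ * X ^ 2 := by
    rw [← reflect_two_quadratic, hQ, Polynomial.C_0, zero_mul, zero_add]
  have hsum : reflect 2 R + reflect 2 P =
      Polynomial.C 2 + Polynomial.C (b₁ + a₁) * X + Polynomial.C (b₂ + a₂) * X ^ 2 := by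
    rw [hR', hP', ← one_add_one_eq_two (R := ℂ)]
    simp only [Polynomial.C_add]
    ring
  have hdiff : reflect 2 R - reflect 2 P =
      Polynomial.C 0 + Polynomial.C (b₁ - a₁) * X + Polynomial.C (b₂ - a₂) * X ^ 2 := by
    rw [hR', hP']
    simp only [Polynomial.C_sub, Polynomial.C_0]
    ring
  have htwo : reflect 2 Q + reflect 2 Q =
      Polynomial.C 0 + Polynomial.C (c₁ + c₁) * X + Polynomial.C (c₂ + c₂) * X ^ 2 := by
    rw [hQ']
    simp only [Polynomial.C_add, Polynomial.C_0]
    ring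
  rw [← Polynomial.coe_sub, ← Polynomial.coe_add, hsum, hdiff] at hm
  rw [two_mul, ← Polynomial.coe_add, ← Polynomial.coe_add, hsum, htwo] at hq
  obtain ⟨m_one, m_two, m_rec⟩ := recurrence_of_eq_mul_tailSeries hm
  obtain ⟨q_one, q_two, -⟩ := recurrence_of_eq_mul_tailSeries hq
  have m_three : 2 * m 2 + (b₁ + a₁) * m 1 + (b₂ + a₂) * m 0 = 0 := m_rec 0
  have m_four : 2 * m 3 + (b₁ + a₁) * m 2 + (b₂ + a₂) * m 1 = 0 := m_rec 1
  have hne' : m 0 * m 2 - m 1 ^ 2 ≠ 0 := by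
    rwa [← neg_ne_zero, neg_sub]
  have hs : (b₁ + a₁) * (m 1 ^ 2 - m 0 * m 2) = 2 * (m 0 * m 3 - m 1 * m 2) := by
    linear_combination m 1 * m_three - m 0 * m_four
  have hu : (b₂ + a₂) * (m 1 ^ 2 - m 0 * m 2) = 2 * (m 2 ^ 2 - m 1 * m 3) := by
    linear_combination m 1 * m_four - m 2 * m_three
  refine ⟨?_, ?_, ?_, ?_, ?_, ?_⟩
  · rw [eq_div_iff hne]
    linear_combination hs / 2 - (m 1 ^ 2 - m 0 * m 2) / 2 * m_one
  · rw [eq_div_iff hne']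
    linear_combination -hu / 2 + m 0 / 2 * hs + (m 1 ^ 2 - m 0 * m 2) / 2 * m_two
  · rw [eq_div_iff hne]
    linear_combination hs / 2 + (m 1 ^ 2 - m 0 * m 2) / 2 * m_one
  · rw [eq_div_iff hne]
    linear_combination hu / 2 + m 0 / 2 * hs + (m 1 ^ 2 - m 0 * m 2) / 2 * m_two
  · linear_combination q_one / 2
  · rw [eq_div_iff hne]
    linear_combination q 0 / 2 * hs + (m 1 ^ 2 - m 0 * m 2) / 2 * q_two
end
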